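/- Smoothness of the softmax objective: for the softmax policy π_θ with linear preferences over a finite action set A and bounded reward r, the gradient map θ ↦ ∇_θ J(θ) of the entropy-regularized objective J(θ) := Σ_a π_θ(a) r(a) − τ D_KL(π_θ‖π̄) is Lipschitz, i.e. there exists L ≥ 0 such that ‖∇_θ J(θ) − ∇_θ J(θ')‖ ≤ L ‖θ − θ'‖ for all θ, θ' ∈ ℝ^P. -/

import Mathlib

/-- A map that is both bounded and Lipschitz, with a common constant. -/
def BoundedLipschitz {E V : Type*} [NormedAddCommGroup E] [NormedAddCommGroup V]
    (f : E → V) : Prop :=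
  ∃ C : ℝ, 0 ≤ C ∧ (∀ x, ‖f x‖ ≤ C) ∧ ∀ x y, ‖f x - f y‖ ≤ C * ‖x - y‖

namespace BoundedLipschitz

variable {E V : Type*} [NormedAddCommGroup E] [NormedAddCommGroup V]

theorem const (v : V) : BoundedLipschitz fun _ : E => v :=
  ⟨‖v‖, norm_nonneg v, fun _ => le_rfl, fun x y => by rw [sub_self, norm_zero]; positivity⟩

theorem add {f g : E → V} (hf : BoundedLipschitz f) (hg : BoundedLipschitz g) :
    BoundedLipschitz fun x => f x + g x := by
  obtain ⟨C, hC, hfb, hfl⟩ := hf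
  obtain ⟨D, hD, hgb, hgl⟩ := hg
  refine ⟨C + D, by positivity, fun x => norm_add_le_of_le (hfb x) (hgb x), fun x y => ?_⟩
  rw [add_sub_add_comm, add_mul]
  exact norm_add_le_of_le (hfl x y) (hgl x y)

theorem sum {ι : Type*} (s : Finset ι) {f : ι → E → V}
    (hf : ∀ i, BoundedLipschitz (f i)) : BoundedLipschitz fun x => ∑ i ∈ s, f i x := by
  classical
  induction s using Finset.induction_on with
  | empty => simpa using const (E := E) (0 : V)
  | insert i s hi ih => simpa [Finset.sum_insert hi] using (hf i).add ih

variable [NormedSpace ℝ V]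

theorem smul {f : E → ℝ} {g : E → V} (hf : BoundedLipschitz f) (hg : BoundedLipschitz g) :
    BoundedLipschitz fun x => f x • g x := by
  obtain ⟨C, hC, hfb, hfl⟩ := hf
  obtain ⟨D, hD, hgb, hgl⟩ := hg
  refine ⟨2 * (C * D), by positivity, fun x => ?_, fun x y => ?_⟩
  · rw [norm_smul]
    have := mul_le_mul (hfb x) (hgb x) (norm_nonneg _) hC
    have := mul_nonneg hC hD
    linarith
  · have h : f x • g x - f y • g y = f x • (g x - g y) + (f x - f y) • g y := by
      rw [smul_sub, sub_smul]; abel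
    calc ‖f x • g x - f y • g y‖ ≤ C * (D * ‖x - y‖) + C * ‖x - y‖ * D := by
          rw [h]
          refine norm_add_le_of_le ?_ ?_ <;> rw [norm_smul]
          · exact mul_le_mul (hfb x) (hgl x y) (norm_nonneg _) hC
          · exact mul_le_mul (hfl x y) (hgb y) (norm_nonneg _) (by positivity)
      _ = 2 * (C * D) * ‖x - y‖ := by ring

theorem of_hasFDerivAt [NormedSpace ℝ E] {f : E → V} {f' : E → E →L[ℝ] V} {B C : ℝ}
    (hf : ∀ x, HasFDerivAt f (f' x) x) (hB : ∀ x, ‖f x‖ ≤ B) (hC : ∀ x, ‖f' x‖ ≤ C) :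
    BoundedLipschitz f := by
  refine ⟨max B C, (norm_nonneg _).trans ((hB 0).trans (le_max_left _ _)),
    fun x => (hB x).trans (le_max_left _ _), fun x y => ?_⟩
  exact convex_univ.norm_image_sub_le_of_norm_hasFDerivWithin_le
    (fun z _ => (hf z).hasFDerivWithinAt) (fun z _ => (hC z).trans (le_max_right _ _))
    (Set.mem_univ y) (Set.mem_univ x)

end BoundedLipschitz

theorem abs_mul_log_div_le {x p : ℝ} (hx : 0 < x) (hx1 : x ≤ 1) (hp : 0 < p) :
    |x * Real.log (x / p)| ≤ 1 + |Real.log p| := by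
  rw [Real.log_div hx.ne' hp.ne', mul_sub]
  refine (abs_sub _ _).trans (add_le_add ?_ ?_)
  · rw [mul_comm]
    exact (Real.abs_log_mul_self_lt x hx hx1).le
  · rw [abs_mul, abs_of_pos hx]
    exact mul_le_of_le_one_left (abs_nonneg _) hx1

section Softmax

variable {A E : Type*} [Fintype A] [NormedAddCommGroup E] [NormedSpace ℝ E]

/-- The softmax weights with base weights `w` and linear preferences `c`. -/
noncomputable def softmaxWeight (w : A → ℝ) (c : A → E →L[ℝ] ℝ) (a : A) (x : E) : ℝ :=
  w a * Real.exp (c a x) / ∑ b, w b * Real.exp (c b x)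

/-- The preference `c a` centred at its softmax average; this is the derivative of
`x ↦ log (softmaxWeight w c a x)`. -/
noncomputable def softmaxScore (w : A → ℝ) (c : A → E →L[ℝ] ℝ) (a : A) (x : E) : E →L[ℝ] ℝ :=
  c a - ∑ b, softmaxWeight w c b x • c b

variable [Nonempty A] {w : A → ℝ} (c : A → E →L[ℝ] ℝ)

theorem softmaxPartition_pos (hw : ∀ a, 0 < w a) (x : E) :
    0 < ∑ b, w b * Real.exp (c b x) :=
  Finset.sum_pos (fun b _ => mul_pos (hw b) (Real.exp_pos _)) Finset.univ_nonempty

theorem softmaxWeight_pos (hw : ∀ a, 0 < w a) (a : A) (x : E) : 0 < softmaxWeight w c a x :=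
  div_pos (mul_pos (hw a) (Real.exp_pos _)) (softmaxPartition_pos c hw x)

theorem softmaxWeight_le_one (hw : ∀ a, 0 < w a) (a : A) (x : E) :
    softmaxWeight w c a x ≤ 1 :=
  (div_le_one (softmaxPartition_pos c hw x)).2 <|
    Finset.single_le_sum (f := fun b => w b * Real.exp (c b x))
      (fun b _ => (mul_pos (hw b) (Real.exp_pos _)).le) (Finset.mem_univ a)

theorem norm_softmaxWeight_le_one (hw : ∀ a, 0 < w a) (a : A) (x : E) :
    ‖softmaxWeight w c a x‖ ≤ 1 := by
  rw [Real.norm_of_nonneg (softmaxWeight_pos c hw a x).le]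
  exact softmaxWeight_le_one c hw a x

theorem norm_softmaxScore_le (hw : ∀ a, 0 < w a) (a : A) (x : E) :
    ‖softmaxScore w c a x‖ ≤ ‖c a‖ + ∑ b, ‖c b‖ := by
  refine norm_sub_le_of_le le_rfl (norm_sum_le_of_le _ fun b _ => ?_)
  rw [norm_smul]
  exact mul_le_of_le_one_left (norm_nonneg _) (norm_softmaxWeight_le_one c hw b x)

theorem log_softmaxWeight_div (hw : ∀ a, 0 < w a) (a : A) (x : E) :
    Real.log (softmaxWeight w c a x / w a) = c a x - Real.log (∑ b, w b * Real.exp (c b x)) := by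
  have h : softmaxWeight w c a x / w a = Real.exp (c a x) / ∑ b, w b * Real.exp (c b x) := by
    have := (hw a).ne'
    have := (softmaxPartition_pos c hw x).ne'
    unfold softmaxWeight
    field_simp
  rw [h, Real.log_div (Real.exp_pos _).ne' (softmaxPartition_pos c hw x).ne', Real.log_exp]

theorem hasFDerivAt_log_softmaxWeight_div (hw : ∀ a, 0 < w a) (a : A) (x : E) :
    HasFDerivAt (fun y => Real.log (softmaxWeight w c a y / w a)) (softmaxScore w c a x) x := by
  have hZ : HasFDerivAt (fun y => ∑ b, w b * Real.exp (c b y))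
      (∑ b, w b • Real.exp (c b x) • c b) x :=
    HasFDerivAt.fun_sum fun b _ => ((c b).hasFDerivAt.exp.const_mul (w b))
  have h := (c a).hasFDerivAt.fun_sub (hZ.log (softmaxPartition_pos c hw x).ne')
  simp_rw [log_softmaxWeight_div c hw]
  refine h.congr_fderiv ?_
  rw [softmaxScore, Finset.smul_sum]
  congr 1
  refine Finset.sum_congr rfl fun b _ => ?_
  rw [smul_smul, smul_smul, softmaxWeight, div_eq_inv_mul, mul_assoc]

theorem hasFDerivAt_softmaxWeight (hw : ∀ a, 0 < w a) (a : A) (x : E) :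
    HasFDerivAt (softmaxWeight w c a) (softmaxWeight w c a x • softmaxScore w c a x) x := by
  have h_eq (y : E) : softmaxWeight w c a y =
      w a * Real.exp (Real.log (softmaxWeight w c a y / w a)) := by
    rw [Real.exp_log (div_pos (softmaxWeight_pos c hw a y) (hw a)),
      mul_div_cancel₀ _ (hw a).ne']
  have h := (hasFDerivAt_log_softmaxWeight_div c hw a x).exp.const_mul (w a)
  rw [smul_smul, ← h_eq] at h
  exact h.congr_of_eventuallyEq (Filter.Eventually.of_forall h_eq)

theorem boundedLipschitz_softmaxWeight (hw : ∀ a, 0 < w a) (a : A) :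
    BoundedLipschitz (softmaxWeight w c a) := by
  refine .of_hasFDerivAt (hasFDerivAt_softmaxWeight c hw a)
    (norm_softmaxWeight_le_one c hw a) (C := ‖c a‖ + ∑ b, ‖c b‖) fun x => ?_
  rw [norm_smul]
  exact (mul_le_of_le_one_left (norm_nonneg _) (norm_softmaxWeight_le_one c hw a x)).trans
    (norm_softmaxScore_le c hw a x)

theorem boundedLipschitz_softmaxScore (hw : ∀ a, 0 < w a) (a : A) :
    BoundedLipschitz (softmaxScore w c a) := by
  have h := (BoundedLipschitz.const (E := E) (c a)).add
    (.smul (.const (-1)) (.sum Finset.univ fun b =>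
      (boundedLipschitz_softmaxWeight c hw b).smul (.const (c b))))
  convert h using 2 with x
  rw [softmaxScore, neg_one_smul, sub_eq_add_neg]

theorem hasFDerivAt_softmaxWeight_mul_log (hw : ∀ a, 0 < w a) (a : A) (x : E) :
    HasFDerivAt (fun y => softmaxWeight w c a y * Real.log (softmaxWeight w c a y / w a))
      ((softmaxWeight w c a x + softmaxWeight w c a x * Real.log (softmaxWeight w c a x / w a)) •
        softmaxScore w c a x) x := by
  refine ((hasFDerivAt_softmaxWeight c hw a x).fun_mul
    (hasFDerivAt_log_softmaxWeight_div c hw a x)).congr_fderiv ?_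
  rw [add_smul, smul_smul, mul_comm (Real.log _)]

theorem boundedLipschitz_softmaxWeight_mul_log (hw : ∀ a, 0 < w a) (a : A) :
    BoundedLipschitz fun x =>
      softmaxWeight w c a x * Real.log (softmaxWeight w c a x / w a) := by
  have hb (x : E) : ‖softmaxWeight w c a x * Real.log (softmaxWeight w c a x / w a)‖ ≤
      1 + |Real.log (w a)| :=
    abs_mul_log_div_le (softmaxWeight_pos c hw a x) (softmaxWeight_le_one c hw a x) (hw a)
  refine .of_hasFDerivAt (hasFDerivAt_softmaxWeight_mul_log c hw a) hb
    (C := (1 + (1 + |Real.log (w a)|)) * (‖c a‖ + ∑ b, ‖c b‖)) fun x => ?_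
  rw [norm_smul]
  exact mul_le_mul (norm_add_le_of_le (norm_softmaxWeight_le_one c hw a x) (hb x))
    (norm_softmaxScore_le c hw a x) (norm_nonneg _) (by positivity)

theorem boundedLipschitz_fderiv_softmax_objective (hw : ∀ a, 0 < w a) (r : A → ℝ) (τ : ℝ) :
    BoundedLipschitz (fderiv ℝ fun x : E => (∑ a, softmaxWeight w c a x * r a) -
      τ * ∑ a, softmaxWeight w c a x * Real.log (softmaxWeight w c a x / w a)) := by
  have hderiv (x : E) := (HasFDerivAt.fun_sum (u := Finset.univ) fun a _ =>
    (hasFDerivAt_softmaxWeight c hw a x).mul_const (r a)).fun_sub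
      ((HasFDerivAt.fun_sum (u := Finset.univ) fun a _ =>
        hasFDerivAt_softmaxWeight_mul_log c hw a x).const_mul τ)
  rw [funext fun x => (hderiv x).fderiv]
  have hπ := boundedLipschitz_softmaxWeight c hw
  have hs := boundedLipschitz_softmaxScore c hw
  have hl := boundedLipschitz_softmaxWeight_mul_log c hw
  have h := (BoundedLipschitz.sum Finset.univ fun a =>
    (BoundedLipschitz.const (r a)).smul ((hπ a).smul (hs a))).add
      ((BoundedLipschitz.const (-τ)).smul
        (.sum Finset.univ fun a => ((hπ a).add (hl a)).smul (hs a)))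
  simpa only [neg_smul, ← sub_eq_add_neg] using h

end Softmax

open scoped RealInnerProductSpace

/-- Smoothness of the softmax entropy-regularized objective: the
gradient map `θ ↦ ∇_θ J(θ)` is Lipschitz, i.e. there is `L ≥ 0` with
`‖∇_θ J(θ) − ∇_θ J(θ')‖ ≤ L ‖θ − θ'‖` for all `θ, θ'`. (The reward is
automatically bounded since the action set is finite.) -/
theorem softmax_objective_gradient_lipschitz {A : Type*} [Fintype A] [Nonempty A]
    (τ : ℝ) (hτ : 0 < τ)
    (pibar : A → ℝ) (hpibar_pos : ∀ a, 0 < pibar a) (hpibar_sum : ∑ a, pibar a = 1)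
    (r : A → ℝ)
    (P : ℕ) (ψ : A → EuclideanSpace ℝ (Fin P))
    (π : EuclideanSpace ℝ (Fin P) → A → ℝ)
    (hπ : ∀ θ a, π θ a =
      pibar a * Real.exp (⟪θ, ψ a⟫ / τ) / ∑ a', pibar a' * Real.exp (⟪θ, ψ a'⟫ / τ))
    (J : EuclideanSpace ℝ (Fin P) → ℝ)
    (hJ : ∀ θ, J θ = (∑ a, π θ a * r a) - τ * ∑ a, π θ a * Real.log (π θ a / pibar a)) :
    ∃ L : ℝ, 0 ≤ L ∧ ∀ θ θ' : EuclideanSpace ℝ (Fin P),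
      ‖gradient J θ - gradient J θ'‖ ≤ L * ‖θ - θ'‖ := by
  set c : A → EuclideanSpace ℝ (Fin P) →L[ℝ] ℝ := fun a => τ⁻¹ • innerSL ℝ (ψ a)
  have hc (θ a) : ⟪θ, ψ a⟫ / τ = c a θ := by
    simp [c, real_inner_comm, div_eq_inv_mul]
  have hπ' (θ a) : π θ a = softmaxWeight pibar c a θ := by
    simp only [hπ, hc, softmaxWeight]
  obtain ⟨L, hL, -, hlip⟩ := boundedLipschitz_fderiv_softmax_objective c hpibar_pos r τ
  simp_rw [hπ'] at hJ
  rw [← funext hJ] at hlip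
  refine ⟨L, hL, fun θ θ' => ?_⟩
  rw [gradient, gradient, ← map_sub, LinearIsometryEquiv.norm_map]
  exact hlip θ θ'
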